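/- arXiv:2302.01175 — 4 statements merged into one kernel-verified Lean document; each statement's English description precedes it below -/
import Mathlib

section
/- Consider the regularized Lur'e system ẋ ∈ F(x) with F(x) := {Ax + Bu : u ∈ −ΨΨ(Cx)} and suppose Assumptions 1 and 3 hold. Then the system is state-independent output locally asymptotically stable: there exist r > 0 and a class-KL function β such that every Krasovskii solution x : [0,∞) → ℝⁿ with |x(0)| < r satisfies |Cx(t)| ≤ β(|Cx(0)|, t) for all t ≥ 0. -/
open Matrix MeasureTheory Filter Set
open scoped ENNReal

noncomputable section

/-- Euclidean norm on `Fin m → ℝ`. -/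
def euclNorm {m : ℕ} (x : Fin m → ℝ) : ℝ := Real.sqrt (∑ i, x i ^ 2)

/-- Krasovskii regularization of a scalar function `ψ` at `y`:
`Ψ(y) = ⋂_{δ>0} closure (convexHull (ψ '' [y-δ, y+δ]))`. -/
def kras (ψ : ℝ → ℝ) (y : ℝ) : Set ℝ :=
  ⋂ δ ∈ Set.Ioi (0 : ℝ), closure (convexHull ℝ (ψ '' Set.Icc (y - δ) (y + δ)))

/-- Product (decentralized) Krasovskii regularization `ΨΨ(y) = Ψ₁(y₁) × ⋯ × Ψ_p(y_p)`. -/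
def PsiSet {p : ℕ} (ψ : Fin p → ℝ → ℝ) (y : Fin p → ℝ) : Set (Fin p → ℝ) :=
  {w | ∀ i, w i ∈ kras (ψ i) (y i)}

/-- The regularized Lur'e set-valued dynamics `F(x) = {Ax + Bu : u ∈ -ΨΨ(Cx)}`. -/
def lureF {n p : ℕ} (A : Matrix (Fin n) (Fin n) ℝ) (B : Matrix (Fin n) (Fin p) ℝ)
    (C : Matrix (Fin p) (Fin n) ℝ) (ψ : Fin p → ℝ → ℝ) (x : Fin n → ℝ) :
    Set (Fin n → ℝ) :=
  {f | ∃ u : Fin p → ℝ, (fun i => -u i) ∈ PsiSet ψ (C.mulVec x) ∧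
        f = A.mulVec x + B.mulVec u}

/-- Piecewise continuity: finitely many discontinuity points on every compact
interval, and finite one-sided limits at every point. -/
def PiecewiseContinuous (f : ℝ → ℝ) : Prop :=
  (∀ a b : ℝ, {s ∈ Set.Icc a b | ¬ ContinuousAt f s}.Finite) ∧
  (∀ x : ℝ, (∃ L : ℝ, Tendsto f (nhdsWithin x (Set.Ioi x)) (nhds L)) ∧
    (∃ L : ℝ, Tendsto f (nhdsWithin x (Set.Iio x)) (nhds L)))

/-- Sector condition: there is `ζ = 1/z ∈ (0, +∞]` (with `z = ζ⁻¹ ≥ 0`, `z = 0`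
corresponding to `ζ = +∞`) such that `ψ(s)(ψ(s) - ζ s) ≤ 0` for all `s`. -/
def Sector (ψ : ℝ → ℝ) (z : ℝ) : Prop :=
  (z = 0 ∧ ∀ s : ℝ, 0 ≤ s * ψ s) ∨
  (0 < z ∧ ∀ s : ℝ, ψ s * (ψ s - (1 / z) * s) ≤ 0)

/-- Class `KL` functions. -/
def ClassKL (β : ℝ → ℝ → ℝ) : Prop :=
  (∀ t : ℝ, 0 ≤ t → ContinuousOn (fun s => β s t) (Set.Ici 0) ∧
    StrictMonoOn (fun s => β s t) (Set.Ici 0) ∧ β 0 t = 0) ∧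
  (∀ s : ℝ, 0 ≤ s → AntitoneOn (fun t => β s t) (Set.Ici 0) ∧
    Tendsto (fun t => β s t) atTop (nhds 0))

/-- Class `K∞` functions. -/
def ClassKInf (α : ℝ → ℝ) : Prop :=
  ContinuousOn α (Set.Ici 0) ∧ StrictMonoOn α (Set.Ici 0) ∧ α 0 = 0 ∧
  Tendsto α atTop atTop

/-- A Krasovskii solution of `ẋ ∈ F(x)` on a time set `s` (a locally absolutely
continuous function whose derivative belongs to `F(x(t))` almost everywhere),
formalized through the integral representation `x(t) = x(0) + ∫₀ᵗ f(τ) dτ`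
with `f(τ) ∈ F(x(τ))` for a.e. `τ ∈ s`. -/
def IsKrasovskiiSolutionOn {n : ℕ} (F : (Fin n → ℝ) → Set (Fin n → ℝ))
    (x : ℝ → Fin n → ℝ) (s : Set ℝ) : Prop :=
  ∃ f : ℝ → Fin n → ℝ,
    (∀ t ∈ s, IntervalIntegrable f volume 0 t) ∧
    (∀ᵐ t ∂volume, t ∈ s → f t ∈ F (x t)) ∧
    ∀ t ∈ s, x t = x 0 + ∫ τ in (0:ℝ)..t, f τ

/-- The time interval `[0, T)` with `T ∈ (0, +∞]`. -/
def timeItv (T : ℝ≥0∞) : Set ℝ := {t : ℝ | 0 ≤ t ∧ ENNReal.ofReal t < T}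

/-- Global asymptotic stability of the origin: a class-`KL` bound holds along
every Krasovskii solution on every time interval `[0, T)`. -/
def GASOrigin {n p : ℕ} (A : Matrix (Fin n) (Fin n) ℝ) (B : Matrix (Fin n) (Fin p) ℝ)
    (C : Matrix (Fin p) (Fin n) ℝ) (ψ : Fin p → ℝ → ℝ) : Prop :=
  ∃ β : ℝ → ℝ → ℝ, ClassKL β ∧
    ∀ T : ℝ≥0∞, ∀ x : ℝ → Fin n → ℝ,
      IsKrasovskiiSolutionOn (lureF A B C ψ) x (timeItv T) →
      ∀ t ∈ timeItv T, euclNorm (x t) ≤ β (euclNorm (x 0)) t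

/-- The piecewise linear function with slope `a` on the right and `b` on the left of `0`,
provided `b ≤ a`. -/
def tent (a b s : ℝ) : ℝ := max (a * s) (b * s)

lemma lipschitzWith_tent (a b : ℝ) : ∃ K, LipschitzWith K (tent a b) :=
  ⟨_, (LipschitzWith.of_dist_le_mul (K := ‖a‖₊) fun x y => by
      simp [Real.dist_eq, ← mul_sub, abs_mul]).max
    (LipschitzWith.of_dist_le_mul (K := ‖b‖₊) fun x y => by
      simp [Real.dist_eq, ← mul_sub, abs_mul])⟩

lemma mul_abs_le_tent {a b m : ℝ} (ha : m ≤ a) (hb : m ≤ -b) (s : ℝ) : m * |s| ≤ tent a b s := by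
  rcases le_total 0 s with h | h
  · rw [abs_of_nonneg h]
    exact (mul_le_mul_of_nonneg_right ha h).trans (le_max_left _ _)
  · rw [abs_of_nonpos h]
    exact le_trans (by nlinarith) (le_max_right _ _)

lemma tent_le_mul_abs (a b s : ℝ) : tent a b s ≤ (|a| + |b|) * |s| := by
  refine max_le ?_ ?_ <;> refine (le_abs_self _).trans ?_ <;> rw [abs_mul] <;> gcongr
  · linarith [abs_nonneg b]
  · linarith [abs_nonneg a]

lemma tent_of_nonneg {a b s : ℝ} (hab : b ≤ a) (hs : 0 ≤ s) : tent a b s = a * s :=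
  max_eq_left (mul_le_mul_of_nonneg_right hab hs)

lemma tent_of_nonpos {a b s : ℝ} (hab : b ≤ a) (hs : s ≤ 0) : tent a b s = b * s :=
  max_eq_right (by nlinarith)

lemma deriv_tent_comp_of_pos {a b y' t : ℝ} {y : ℝ → ℝ} (hab : b ≤ a) (hy : HasDerivAt y y' t)
    (ht : 0 < y t) : deriv (fun τ => tent a b (y τ)) t = a * y' := by
  refine ((hy.const_mul a).congr_of_eventuallyEq ?_).deriv
  filter_upwards [hy.continuousAt.eventually (lt_mem_nhds ht)] with τ hτ
  exact tent_of_nonneg hab (le_of_lt hτ)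

lemma deriv_tent_comp_of_neg {a b y' t : ℝ} {y : ℝ → ℝ} (hab : b ≤ a) (hy : HasDerivAt y y' t)
    (ht : y t < 0) : deriv (fun τ => tent a b (y τ)) t = b * y' := by
  refine ((hy.const_mul b).congr_of_eventuallyEq ?_).deriv
  filter_upwards [hy.continuousAt.eventually (gt_mem_nhds ht)] with τ hτ
  exact tent_of_nonpos hab (le_of_lt hτ)

/-- At a zero of `y`, the nonnegative function `tent a b ∘ y` has a minimum, so that its derivative
vanishes there, and this forces the derivative of `y` to vanish as well. -/
lemma deriv_tent_comp_of_eq_zero {a b y' t : ℝ} {y : ℝ → ℝ} (ha : 0 < a) (hb : b < 0)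
    (hy : HasDerivAt y y' t) (hd : DifferentiableAt ℝ (fun τ => tent a b (y τ)) t)
    (ht : y t = 0) : y' = 0 ∧ deriv (fun τ => tent a b (y τ)) t = 0 := by
  have hm : 0 < min a (-b) := lt_min ha (by linarith)
  have hle := mul_abs_le_tent (min_le_left a (-b)) (min_le_right a (-b))
  have h0 : tent a b (y t) = 0 := by simp [ht, tent]
  have hmin : IsLocalMin (fun τ => tent a b (y τ)) t := Eventually.of_forall fun τ => by
    simp only [h0]
    exact (by positivity : (0 : ℝ) ≤ min a (-b) * |y τ|).trans (hle _)
  have hd0 := hmin.deriv_eq_zero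
  refine ⟨?_, hd0⟩
  have h1 := hd.hasDerivAt
  rw [hd0, hasDerivAt_iff_isLittleO] at h1
  have h2 : HasDerivAt y 0 t := by
    rw [hasDerivAt_iff_isLittleO]
    refine Asymptotics.IsBigO.trans_isLittleO ?_ h1
    refine Asymptotics.IsBigO.of_bound (min a (-b))⁻¹ (Eventually.of_forall fun τ => ?_)
    simp only [h0, smul_zero, sub_zero]
    simp only [ht, sub_zero, Real.norm_eq_abs]
    rw [← div_eq_inv_mul, le_div_iff₀ hm, mul_comm]
    exact (hle _).trans (le_abs_self _)
  exact hy.unique h2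

lemma LipschitzWith.comp_absolutelyContinuousOnInterval {φ g : ℝ → ℝ} {K : NNReal} {a b : ℝ}
    (hφ : LipschitzWith K φ) (hg : AbsolutelyContinuousOnInterval g a b) :
    AbsolutelyContinuousOnInterval (fun t => φ (g t)) a b := by
  unfold AbsolutelyContinuousOnInterval at hg ⊢
  refine squeeze_zero (fun E => Finset.sum_nonneg fun _ _ => dist_nonneg) (fun E => ?_)
    (by simpa using hg.const_mul (K : ℝ))
  rw [Finset.mul_sum]
  exact Finset.sum_le_sum fun i _ => hφ.dist_le_mul _ _

lemma AbsolutelyContinuousOnInterval.finset_sum {ι : Type*} (s : Finset ι) {g : ι → ℝ → ℝ}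
    {a b : ℝ} (hg : ∀ i ∈ s, AbsolutelyContinuousOnInterval (g i) a b) :
    AbsolutelyContinuousOnInterval (fun t => ∑ i ∈ s, g i t) a b := by
  classical
  induction s using Finset.induction_on with
  | empty =>
    simpa using
      ((LipschitzWith.const (0 : ℝ)).lipschitzOnWith (s := uIcc a b)).absolutelyContinuousOnInterval
  | insert i s hi ih =>
    simp only [Finset.sum_insert hi]
    exact (hg i (by simp)).add (ih fun j hj => hg j (by simp [hj]))

lemma AbsolutelyContinuousOnInterval.congr {f g : ℝ → ℝ} {a b : ℝ}
    (hf : AbsolutelyContinuousOnInterval f a b) (h : EqOn f g (uIcc a b)) :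
    AbsolutelyContinuousOnInterval g a b := by
  rw [absolutelyContinuousOnInterval_iff] at hf ⊢
  intro ε hε
  obtain ⟨δ, hδ, H⟩ := hf ε hε
  refine ⟨δ, hδ, fun E hE hs => ?_⟩
  convert! H E hE hs using 1
  refine Finset.sum_congr rfl fun i hi => ?_
  rw [h (hE.1 i hi).1, h (hE.1 i hi).2]

lemma AbsolutelyContinuousOnInterval.le_add_mul {g : ℝ → ℝ} {s t k : ℝ} (hst : s ≤ t)
    (hg : AbsolutelyContinuousOnInterval g s t)
    (hd : ∀ᵐ τ, τ ∈ Icc s t → deriv g τ ≤ k) : g t ≤ g s + k * (t - s) := by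
  have h := hg.integral_deriv_eq_sub
  have h2 : ∫ τ in s..t, deriv g τ ≤ ∫ _ in s..t, k := by
    refine intervalIntegral.integral_mono_ae_restrict hst hg.intervalIntegrable_deriv
      intervalIntegrable_const ?_
    rw [EventuallyLE, ae_restrict_iff' measurableSet_Icc]
    exact hd
  rw [intervalIntegral.integral_const, smul_eq_mul] at h2
  linarith

/-- A nonnegative function that decreases at rate at least `κ` as long as it is positive. -/
lemma le_max_zero_sub_mul {g : ℝ → ℝ} {κ : ℝ} (hκ : 0 ≤ κ) (hg0 : ∀ t, 0 ≤ g t)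
    (hg : ∀ T, 0 ≤ T → AbsolutelyContinuousOnInterval g 0 T)
    (hd : ∀ᵐ t, 0 < t → 0 < g t → deriv g t ≤ -κ)
    {t : ℝ} (ht : 0 ≤ t) : g t ≤ max 0 (g 0 - κ * t) := by
  have hne : ∀ᵐ τ : ℝ, τ ≠ 0 := by simp [ae_iff, measure_singleton]
  have hanti : ∀ s ∈ Icc 0 t, g t ≤ g s := fun s hs => by
    have := AbsolutelyContinuousOnInterval.le_add_mul (k := 0) hs.2
      ((hg t ht).mono (by rw [uIcc_of_le hs.2, uIcc_of_le ht]; exact Icc_subset_Icc_left hs.1)) (by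
        filter_upwards [hd, hne] with τ h1 h2 h3
        have hτ := h1 (lt_of_le_of_ne (hs.1.trans h3.1) h2.symm)
        rcases (hg0 τ).lt_or_eq with h | h
        · linarith [hτ h]
        · exact (IsLocalMin.deriv_eq_zero (Eventually.of_forall fun s => h ▸ hg0 s)).le)
    linarith
  rcases (hg0 t).lt_or_eq with hpos | h0
  · refine le_max_of_le_right ?_
    have := AbsolutelyContinuousOnInterval.le_add_mul (k := -κ) ht (hg t ht) (by
      filter_upwards [hd, hne] with τ h1 h2 h3
      exact h1 (lt_of_le_of_ne h3.1 h2.symm) (hpos.trans_le (hanti τ h3)))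
    linarith
  · exact h0 ▸ le_max_left _ _

lemma abs_sub_le_of_mem_kras {ψ : ℝ → ℝ} {L ε δ y w : ℝ} (hδ : 0 < δ)
    (h : ∀ s ∈ Icc (y - δ) (y + δ), |ψ s - L| ≤ ε) (hw : w ∈ kras ψ y) : |w - L| ≤ ε := by
  have h1 := mem_iInter₂.1 hw δ hδ
  have h2 : closure (convexHull ℝ (ψ '' Icc (y - δ) (y + δ))) ⊆ Metric.closedBall L ε := by
    refine closure_minimal (convexHull_min ?_ (convex_closedBall L ε)) Metric.isClosed_closedBall
    rintro _ ⟨s, hs, rfl⟩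
    simpa [Real.dist_eq] using h s hs
  simpa [Real.dist_eq] using h2 h1

lemma eventually_kras_near_right {ψ : ℝ → ℝ} {L ε : ℝ} (hε : 0 < ε)
    (h : Tendsto ψ (nhdsWithin 0 (Ioi 0)) (nhds L)) :
    ∀ᶠ δ in nhdsWithin (0 : ℝ) (Ioi 0), ∀ y, 0 < y → y < δ → ∀ w ∈ kras ψ y, |w - L| ≤ ε := by
  obtain ⟨u, hu, H⟩ := mem_nhdsGT_iff_exists_Ioo_subset.1 (h (Metric.closedBall_mem_nhds L hε))
  filter_upwards [Ioo_mem_nhdsGT hu] with δ hδ y hy hyδ w hw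
  have hr : 0 < min y (u - y) / 2 := by
    have : 0 < min y (u - y) := lt_min hy (by linarith [hδ.2])
    linarith
  refine abs_sub_le_of_mem_kras hr (fun s hs => ?_) hw
  have h1 := min_le_left y (u - y)
  have h2 := min_le_right y (u - y)
  have := H (show s ∈ Ioo 0 u from ⟨by linarith [hs.1], by linarith [hs.2]⟩)
  simpa [Real.dist_eq] using this

lemma eventually_kras_near_left {ψ : ℝ → ℝ} {L ε : ℝ} (hε : 0 < ε)
    (h : Tendsto ψ (nhdsWithin 0 (Iio 0)) (nhds L)) :
    ∀ᶠ δ in nhdsWithin (0 : ℝ) (Ioi 0), ∀ y, y < 0 → -δ < y → ∀ w ∈ kras ψ y, |w - L| ≤ ε := by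
  obtain ⟨u, hu, H⟩ := mem_nhdsLT_iff_exists_Ioo_subset.1 (h (Metric.closedBall_mem_nhds L hε))
  rw [mem_Iio] at hu
  filter_upwards [Ioo_mem_nhdsGT (neg_pos.2 hu)] with δ hδ y hy hyδ w hw
  have hr : 0 < min (-y) (y - u) / 2 := by
    have : 0 < min (-y) (y - u) := lt_min (by linarith) (by linarith [hδ.2])
    linarith
  refine abs_sub_le_of_mem_kras hr (fun s hs => ?_) hw
  have h1 := min_le_left (-y) (y - u)
  have h2 := min_le_right (-y) (y - u)
  have := H (show s ∈ Ioo u 0 from ⟨by linarith [hs.1], by linarith [hs.2]⟩)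
  simpa [Real.dist_eq] using this

lemma Matrix.exists_norm_mulVec_le {m n : ℕ} (M : Matrix (Fin m) (Fin n) ℝ) :
    ∃ K, 0 < K ∧ ∀ v, ‖M.mulVec v‖ ≤ K * ‖v‖ :=
  (LinearMap.toContinuousLinearMap M.mulVecLin).bound

lemma sum_mul_mul_le {p : ℕ} {γ : Fin p → ℝ} (hγ : ∀ i, 0 ≤ γ i) (u v : Fin p → ℝ) :
    ∑ i, γ i * u i * v i ≤ (∑ i, γ i) * ‖u‖ * ‖v‖ := by
  rw [Finset.sum_mul, Finset.sum_mul]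
  refine Finset.sum_le_sum fun i _ => (le_abs_self _).trans ?_
  rw [abs_mul, abs_mul, abs_of_nonneg (hγ i)]
  have := hγ i
  gcongr
  exacts [norm_le_pi_norm u i, norm_le_pi_norm v i]

/-- A matrix with `Γ M + Mᵀ Γ` positive definite satisfies a coercivity estimate. -/
lemma exists_coercive {p : ℕ} (M : Matrix (Fin p) (Fin p) ℝ) (γ : Fin p → ℝ)
    (h : ∀ u : Fin p → ℝ, u ≠ 0 →
      0 < u ⬝ᵥ ((diagonal γ * M + Mᵀ * diagonal γ).mulVec u)) :
    ∃ c, 0 < c ∧ ∀ u : Fin p → ℝ, c * ‖u‖ ^ 2 ≤ ∑ i, γ i * u i * M.mulVec u i := by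
  set q : (Fin p → ℝ) → ℝ := fun u => ∑ i, γ i * u i * M.mulVec u i with hq
  have hqeq : ∀ u, u ⬝ᵥ ((diagonal γ * M + Mᵀ * diagonal γ).mulVec u) = 2 * q u := fun u => by
    have h1 : u ⬝ᵥ ((diagonal γ * M).mulVec u) = q u := by
      rw [← mulVec_mulVec]
      simp only [dotProduct, mulVec_diagonal, hq]
      exact Finset.sum_congr rfl fun i _ => by ring
    have h2 : u ⬝ᵥ ((Mᵀ * diagonal γ).mulVec u) = q u := by
      rw [← mulVec_mulVec, dotProduct_mulVec, vecMul_transpose]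
      simp only [dotProduct, mulVec_diagonal, hq]
      exact Finset.sum_congr rfl fun i _ => by ring
    rw [add_mulVec, dotProduct_add, h1, h2, two_mul]
  have hpos : ∀ u, u ≠ 0 → 0 < q u := fun u hu => by linarith [h u hu, hqeq u]
  have hcont : Continuous q := by
    refine continuous_finsetSum _ fun i _ => ?_
    have : Continuous fun u => M.mulVec u := Continuous.matrix_mulVec continuous_const continuous_id
    fun_prop
  have hhom : ∀ (a : ℝ) u, q (a • u) = a ^ 2 * q u := fun a u => by
    simp only [hq, mulVec_smul, Pi.smul_apply, smul_eq_mul, Finset.mul_sum]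
    exact Finset.sum_congr rfl fun i _ => by ring
  obtain ⟨c, hc, H⟩ : ∃ c, 0 < c ∧ ∀ u ∈ Metric.sphere (0 : Fin p → ℝ) 1, c ≤ q u := by
    rcases (Metric.sphere (0 : Fin p → ℝ) 1).eq_empty_or_nonempty with he | hne
    · exact ⟨1, one_pos, by simp [he]⟩
    · obtain ⟨u, hu, hmin⟩ := (isCompact_sphere _ _).exists_isMinOn hne hcont.continuousOn
      exact ⟨q u, hpos u (ne_zero_of_mem_unit_sphere ⟨u, hu⟩), fun v hv => hmin hv⟩
  refine ⟨c, hc, fun u => ?_⟩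
  rcases eq_or_ne u 0 with rfl | hu
  · simp
  have hn : 0 < ‖u‖ := norm_pos_iff.2 hu
  have h1 := H (‖u‖⁻¹ • u) (by simp [norm_smul, hn.ne'])
  rw [hhom, inv_pow, ← div_eq_inv_mul, le_div_iff₀ (by positivity)] at h1
  exact h1

/-- The decrease estimate: for `x` small, `w` bounded away from zero and `σ` close to `w`, the
derivative of the Lyapunov function is bounded away from zero. -/
lemma exists_decrease {n p : ℕ} (N : Matrix (Fin p) (Fin n) ℝ) (M : Matrix (Fin p) (Fin p) ℝ)
    {γ : Fin p → ℝ} (hγ : ∀ i, 0 ≤ γ i) {c μ : ℝ} (hc : 0 < c)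
    (hM : ∀ u : Fin p → ℝ, c * ‖u‖ ^ 2 ≤ ∑ i, γ i * u i * M.mulVec u i) (hμ : 0 < μ) :
    ∃ ε ρ κ : ℝ, 0 < ε ∧ ε ≤ μ ∧ 0 < ρ ∧ 0 < κ ∧ ∀ (x : Fin n → ℝ) (w σ : Fin p → ℝ),
      ‖x‖ ≤ ρ → μ ≤ ‖w‖ → (∀ i, |σ i - w i| ≤ ε) →
        ∑ i, γ i * σ i * (N.mulVec x - M.mulVec w) i ≤ -κ := by
  obtain ⟨K₁, hK₁, hN⟩ := N.exists_norm_mulVec_le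
  obtain ⟨K₂, hK₂, hM'⟩ := M.exists_norm_mulVec_le
  set G := ∑ i, γ i
  have hG : 0 ≤ G := Finset.sum_nonneg fun i _ => hγ i
  set ε := min μ (c * μ / (4 * (G * K₂ + 1))) with hε
  set ρ := c * μ / (8 * (G * K₁ + 1)) with hρ
  have hε0 : 0 < ε := lt_min hμ (by positivity)
  have hρ0 : 0 < ρ := by positivity
  have hεμ : ε ≤ μ := min_le_left _ _
  have hε1 : G * K₂ * ε ≤ c * μ / 4 := by
    have h1 : ε ≤ c * μ / (4 * (G * K₂ + 1)) := min_le_right _ _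
    rw [le_div_iff₀ (by positivity)] at h1
    linarith
  have hρ1 : G * K₁ * ρ ≤ c * μ / 8 := by
    have h1 : ρ * (8 * (G * K₁ + 1)) = c * μ := by rw [hρ]; field_simp
    linarith
  refine ⟨ε, ρ, c * μ ^ 2 / 2, hε0, hεμ, hρ0, by positivity, fun x w σ hx hw hσ => ?_⟩
  set W := ‖w‖
  have hσ' : ‖σ - w‖ ≤ ε := (pi_norm_le_iff_of_nonneg hε0.le).2 fun i => by simpa using hσ i
  have hNx : ‖N.mulVec x‖ ≤ K₁ * ρ := (hN x).trans (by gcongr)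
  have hz : ‖N.mulVec x - M.mulVec w‖ ≤ K₁ * ρ + K₂ * W :=
    (norm_sub_le _ _).trans (add_le_add hNx (hM' w))
  have e : ∑ i, γ i * σ i * (N.mulVec x - M.mulVec w) i =
      ∑ i, γ i * w i * N.mulVec x i - ∑ i, γ i * w i * M.mulVec w i +
        ∑ i, γ i * (σ - w) i * (N.mulVec x - M.mulVec w) i := by
    rw [← Finset.sum_sub_distrib, ← Finset.sum_add_distrib]
    exact Finset.sum_congr rfl fun i _ => by simp only [Pi.sub_apply]; ring
  have h1 : ∑ i, γ i * w i * N.mulVec x i ≤ G * W * (K₁ * ρ) :=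
    (sum_mul_mul_le hγ _ _).trans (by gcongr)
  have h2 : ∑ i, γ i * (σ - w) i * (N.mulVec x - M.mulVec w) i ≤ G * ε * (K₁ * ρ + K₂ * W) :=
    (sum_mul_mul_le hγ _ _).trans (by gcongr)
  have h3 := hM w
  have hW : 0 < W := hμ.trans_le hw
  have h4 : G * K₁ * ρ * W ≤ c * μ / 8 * W := by gcongr
  have h5 : G * K₁ * ρ * ε ≤ c * μ / 8 * W := mul_le_mul hρ1 (hεμ.trans hw) hε0.le (by positivity)
  have h6 : G * K₂ * ε * W ≤ c * μ / 4 * W := by gcongr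
  have h7 : c * μ * W ≤ c * W * W := by gcongr
  have h8 : c * μ ^ 2 ≤ c * W * W := by
    rw [mul_assoc, ← pow_two]; gcongr
  rw [e]
  nlinarith

lemma abs_le_euclNorm {m : ℕ} (x : Fin m → ℝ) (i : Fin m) : |x i| ≤ euclNorm x :=
  Real.abs_le_sqrt (Finset.single_le_sum (f := fun i => x i ^ 2) (fun _ _ => sq_nonneg _)
    (Finset.mem_univ i))

lemma euclNorm_nonneg {m : ℕ} (x : Fin m → ℝ) : 0 ≤ euclNorm x := Real.sqrt_nonneg _

lemma norm_le_euclNorm {m : ℕ} (x : Fin m → ℝ) : ‖x‖ ≤ euclNorm x :=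
  (pi_norm_le_iff_of_nonneg (euclNorm_nonneg x)).2 (abs_le_euclNorm x)

lemma euclNorm_le_sum_abs {m : ℕ} (x : Fin m → ℝ) : euclNorm x ≤ ∑ i, |x i| := by
  refine Real.sqrt_le_iff.2 ⟨Finset.sum_nonneg fun _ _ => abs_nonneg _, ?_⟩
  simpa [sq_abs] using Finset.sum_sq_le_sq_sum_of_nonneg (s := Finset.univ) (f := fun i => |x i|)
    fun i _ => abs_nonneg _

lemma classKL_max_zero_sub {D E κ : ℝ} (hD : 0 ≤ D) (hE : 0 ≤ E) (hκ : 0 < κ) :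
    ClassKL fun s t => D * max 0 (E * s - κ * t) + s * Real.exp (-t) := by
  refine ⟨fun t ht => ⟨by fun_prop, fun s hs s' hs' hss => ?_, ?_⟩,
    fun s hs => ⟨fun t ht t' ht' htt => ?_, ?_⟩⟩
  · have h1 : D * max 0 (E * s - κ * t) ≤ D * max 0 (E * s' - κ * t) := by gcongr
    have h2 : s * Real.exp (-t) < s' * Real.exp (-t) := by gcongr
    simp only
    linarith
  · have : -(κ * t) ≤ 0 := by have := mul_nonneg hκ.le ht; linarith
    simp [this]
  · have hs' : 0 ≤ s := hs
    simp only
    gcongr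
  · have h1 : Tendsto (fun t => s * Real.exp (-t)) atTop (nhds 0) := by
      simpa using (Real.tendsto_exp_neg_atTop_nhds_zero).const_mul s
    refine h1.congr' ?_
    filter_upwards [eventually_ge_atTop (E * s / κ)] with t ht
    rw [div_le_iff₀ hκ] at ht
    rw [max_eq_left (by linarith)]
    simp

lemma timeItv_top : timeItv ⊤ = Ici 0 := by
  ext t; simp [timeItv]

/-- Lyapunov stability extracted from a class-`KL` bound. -/
lemma ClassKL.exists_radius {β : ℝ → ℝ → ℝ} (hβ : ClassKL β) {ρ : ℝ} (hρ : 0 < ρ) :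
    ∃ r, 0 < r ∧ ∀ s t, 0 ≤ s → s < r → 0 ≤ t → β s t < ρ := by
  obtain ⟨hc, -, h0⟩ := hβ.1 0 le_rfl
  have h1 := (hc 0 self_mem_Ici).eventually (gt_mem_nhds (by simpa [h0] using hρ : β 0 0 < ρ))
  obtain ⟨r, hr, H⟩ := mem_nhdsGE_iff_exists_Ico_subset.1 h1
  exact ⟨r, hr, fun s t hs hsr ht =>
    ((hβ.2 s hs).1 self_mem_Ici ht ht).trans_lt (H ⟨hs, hsr⟩)⟩

lemma IsKrasovskiiSolutionOn.absolutelyContinuousOnInterval {n : ℕ}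
    {F : (Fin n → ℝ) → Set (Fin n → ℝ)} {x : ℝ → Fin n → ℝ}
    (hx : IsKrasovskiiSolutionOn F x (Ici 0)) (l : (Fin n → ℝ) →L[ℝ] ℝ) {T : ℝ} (hT : 0 ≤ T) :
    AbsolutelyContinuousOnInterval (fun t => l (x t)) 0 T := by
  obtain ⟨f, hint, -, hxf⟩ := hx
  have hlint : IntervalIntegrable (fun t => l (f t)) volume 0 T :=
    ⟨l.integrable_comp (hint T hT).1, l.integrable_comp (hint T hT).2⟩
  have h1 := hlint.absolutelyContinuousOnInterval_intervalIntegral left_mem_uIcc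
  have h2 : LipschitzWith 1 fun s : ℝ => l (x 0) + s := (isometry_add_left _).lipschitz
  refine (h2.comp_absolutelyContinuousOnInterval h1).congr fun t ht => ?_
  rw [uIcc_of_le hT] at ht
  simp only
  rw [hxf t ht.1, map_add, l.intervalIntegral_comp_comm (hint t ht.1)]

lemma IsKrasovskiiSolutionOn.ae_hasDerivAt {n : ℕ}
    {F : (Fin n → ℝ) → Set (Fin n → ℝ)} {x : ℝ → Fin n → ℝ}
    (hx : IsKrasovskiiSolutionOn F x (Ici 0)) :
    ∀ᵐ t, 0 < t → ∃ v ∈ F (x t), HasDerivAt x v t := by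
  obtain ⟨f, hint, hF, hxf⟩ := hx
  have h := ae_all_iff.2 fun N : ℕ => (hint N (mem_Ici.2 N.cast_nonneg)).ae_hasDerivAt_integral
  filter_upwards [hF, h] with t h1 h2 ht
  refine ⟨f t, h1 ht.le, ?_⟩
  obtain ⟨N, hN⟩ := exists_nat_ge t
  have h3 := h2 N (by rw [uIcc_of_le N.cast_nonneg]; exact ⟨ht.le, hN⟩) 0 left_mem_uIcc
  refine (h3.const_add (x 0)).congr_of_eventuallyEq ?_
  filter_upwards [lt_mem_nhds ht] with τ hτ using hxf τ (le_of_lt hτ)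

lemma AbsolutelyContinuousOnInterval.ae_differentiableAt_of_pos {g : ℝ → ℝ}
    (hg : ∀ T, 0 ≤ T → AbsolutelyContinuousOnInterval g 0 T) :
    ∀ᵐ t, 0 < t → DifferentiableAt ℝ g t := by
  have h := ae_all_iff.2 fun N : ℕ => (hg N N.cast_nonneg).ae_differentiableAt
  filter_upwards [h] with t h2 ht
  obtain ⟨N, hN⟩ := exists_nat_ge t
  exact h2 N (by rw [uIcc_of_le N.cast_nonneg]; exact ⟨ht.le, hN⟩)

lemma eventually_nhdsGT_zero_le {a : ℝ} (ha : 0 < a) : ∀ᶠ m in nhdsWithin (0 : ℝ) (Ioi 0), m ≤ a :=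
  (eventually_le_nhds ha).filter_mono nhdsWithin_le_nhds

/-- under Assumptions 1 and 3, the regularized Lur'e system is
state-independent output locally asymptotically stable. -/
theorem stmt8 {n p : ℕ} (A : Matrix (Fin n) (Fin n) ℝ) (B : Matrix (Fin n) (Fin p) ℝ)
    (C : Matrix (Fin p) (Fin n) ℝ) (ψ : Fin p → ℝ → ℝ)
    -- Assumption 1
    (hA1 : ∀ i, PiecewiseContinuous (ψ i) ∧ ∃ z : ℝ, Sector (ψ i) z)
    -- Assumption 3 (i): CB is Lyapunov diagonally stable
    (hLDS : ∃ γb : Fin p → ℝ, (∀ i, 0 < γb i) ∧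
      ∀ u : Fin p → ℝ, u ≠ 0 →
        0 < u ⬝ᵥ ((Matrix.diagonal γb * (C * B) + (C * B)ᵀ * Matrix.diagonal γb).mulVec u))
    -- Assumption 3 (ii): the origin is GAS
    (hGAS : GASOrigin A B C ψ)
    -- Assumption 3 (iii): discontinuity at the origin with sign-definite limits
    (hdisc : ∀ i, ¬ ContinuousAt (ψ i) 0 ∧
      (∃ L : ℝ, 0 < L ∧ Tendsto (ψ i) (nhdsWithin 0 (Set.Ioi 0)) (nhds L)) ∧
      (∃ L : ℝ, L < 0 ∧ Tendsto (ψ i) (nhdsWithin 0 (Set.Iio 0)) (nhds L))) :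
    ∃ r : ℝ, 0 < r ∧ ∃ β : ℝ → ℝ → ℝ, ClassKL β ∧
      ∀ x : ℝ → Fin n → ℝ,
        IsKrasovskiiSolutionOn (lureF A B C ψ) x (Set.Ici 0) →
        euclNorm (x 0) < r →
        ∀ t : ℝ, 0 ≤ t →
          euclNorm (C.mulVec (x t)) ≤ β (euclNorm (C.mulVec (x 0))) t := by
  choose γ hγ hγM using hLDS
  choose _ hright hleft using hdisc
  choose a ha hta using hright
  choose b hb htb using hleft
  obtain ⟨β₀, hβ₀, hGAS⟩ := hGAS
  obtain ⟨c, hc, hcoer⟩ := exists_coercive (C * B) γ hγM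
  obtain ⟨μ, hμab, hμ⟩ : ∃ μ : ℝ, (∀ i, 2 * μ ≤ a i ∧ 2 * μ ≤ -b i) ∧ 0 < μ := by
    refine Eventually.exists (f := nhdsWithin (0 : ℝ) (Ioi 0))
      ((eventually_all.2 fun i => ?_).and self_mem_nhdsWithin)
    filter_upwards [eventually_nhdsGT_zero_le (half_pos (ha i)),
      eventually_nhdsGT_zero_le (half_pos (neg_pos.2 (hb i)))] with m h1 h2
    constructor <;> linarith
  obtain ⟨m, hmab, hm⟩ : ∃ m : ℝ, (∀ i, m ≤ γ i * (2 * μ)) ∧ 0 < m :=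
    Eventually.exists (f := nhdsWithin (0 : ℝ) (Ioi 0)) ((eventually_all.2 fun i =>
      eventually_nhdsGT_zero_le (mul_pos (hγ i) (by positivity))).and self_mem_nhdsWithin)
  obtain ⟨ε, ρ, κ, hε, hεμ, hρ, hκ, hdec⟩ :=
    exists_decrease (C * A) (C * B) (fun i => (hγ i).le) hc hcoer hμ
  obtain ⟨δ, hδ, hδ0⟩ : ∃ δ : ℝ, (∀ i, (∀ y, 0 < y → y < δ → ∀ w ∈ kras (ψ i) y, |w - a i| ≤ ε) ∧
      ∀ y, y < 0 → -δ < y → ∀ w ∈ kras (ψ i) y, |w - b i| ≤ ε) ∧ 0 < δ :=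
    Eventually.exists (f := nhdsWithin (0 : ℝ) (Ioi 0)) ((eventually_all.2 fun i =>
      (eventually_kras_near_right hε (hta i)).and (eventually_kras_near_left hε (htb i))).and
        self_mem_nhdsWithin)
  obtain ⟨K, hK, hC⟩ := C.exists_norm_mulVec_le
  obtain ⟨r, hr, hrad⟩ := hβ₀.exists_radius (lt_min hρ (div_pos hδ0 hK))
  set E := ∑ i, γ i * (|a i| + |b i|) with hE
  have hE0 : 0 ≤ E := Finset.sum_nonneg fun i _ => by have := hγ i; positivity
  refine ⟨r, hr, _, classKL_max_zero_sub (inv_nonneg.2 hm.le) hE0 hκ, fun x hx hx0 t ht => ?_⟩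
  have hsmall : ∀ t, 0 ≤ t → ‖x t‖ < min ρ (δ / K) := fun t ht =>
    (norm_le_euclNorm _).trans_lt ((hGAS ⊤ x (timeItv_top ▸ hx) t (timeItv_top ▸ ht)).trans_lt
      (hrad _ _ (euclNorm_nonneg _) hx0 ht))
  let l (i : Fin p) : (Fin n → ℝ) →L[ℝ] ℝ :=
    (ContinuousLinearMap.proj i).comp (LinearMap.toContinuousLinearMap C.mulVecLin)
  have hl : ∀ i v, l i v = C.mulVec v i := fun i v => rfl
  let g (i : Fin p) (t : ℝ) : ℝ := tent (a i) (b i) (l i (x t))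
  let V (t : ℝ) : ℝ := ∑ i, γ i * g i t
  have hab : ∀ i, b i ≤ a i := fun i => ((hb i).trans (ha i)).le
  have hgAC : ∀ i T, 0 ≤ T → AbsolutelyContinuousOnInterval (g i) 0 T := fun i T hT => by
    obtain ⟨L, hL⟩ := lipschitzWith_tent (a i) (b i)
    exact hL.comp_absolutelyContinuousOnInterval (hx.absolutelyContinuousOnInterval (l i) hT)
  have hVAC : ∀ T, 0 ≤ T → AbsolutelyContinuousOnInterval V 0 T := fun T hT =>
    AbsolutelyContinuousOnInterval.finset_sum _ fun i _ => (hgAC i T hT).const_mul (γ i)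
  have hVlow : ∀ t, m * ∑ i, |C.mulVec (x t) i| ≤ V t := fun t => by
    rw [Finset.mul_sum]
    refine Finset.sum_le_sum fun i _ => ?_
    have h1 := mul_abs_le_tent (hμab i).1 (hμab i).2 (C.mulVec (x t) i)
    calc m * |C.mulVec (x t) i| ≤ γ i * (2 * μ) * |C.mulVec (x t) i| := by gcongr; exact hmab i
      _ = γ i * (2 * μ * |C.mulVec (x t) i|) := by ring
      _ ≤ γ i * g i t := mul_le_mul_of_nonneg_left h1 (hγ i).le
  have hV0 : ∀ t, 0 ≤ V t := fun t =>
    (mul_nonneg hm.le (Finset.sum_nonneg fun _ _ => abs_nonneg _)).trans (hVlow t)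
  have hVup : V 0 ≤ E * euclNorm (C.mulVec (x 0)) := by
    rw [hE, Finset.sum_mul]
    refine Finset.sum_le_sum fun i _ => ?_
    rw [mul_assoc]
    refine mul_le_mul_of_nonneg_left ((tent_le_mul_abs _ _ _).trans ?_) (hγ i).le
    gcongr
    exact abs_le_euclNorm (C.mulVec (x 0)) i
  have hderiv : ∀ᵐ t, 0 < t → 0 < V t → deriv V t ≤ -κ := by
    have hdiff := ae_all_iff.2 fun i =>
      AbsolutelyContinuousOnInterval.ae_differentiableAt_of_pos (hgAC i)
    filter_upwards [hx.ae_hasDerivAt, hdiff] with t h1 h2 ht hVt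
    obtain ⟨v, ⟨u, hu, rfl⟩, hxv⟩ := h1 ht
    set w : Fin p → ℝ := fun i => -u i with hw
    have hwu : u = -w := by ext i; simp [hw]
    have hy : ∀ i, HasDerivAt (fun τ => l i (x τ))
        (((C * A).mulVec (x t) - (C * B).mulVec w) i) t := fun i => by
      convert! (l i).hasFDerivAt.comp_hasDerivAt t hxv using 1
      rw [hl, hwu, mulVec_neg, ← sub_eq_add_neg, mulVec_sub, mulVec_mulVec, mulVec_mulVec]
    have hyδ : ∀ i, |l i (x t)| < δ := fun i => by
      have h3 := (norm_le_pi_norm (C.mulVec (x t)) i).trans (hC (x t))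
      have h4 := (hsmall t ht.le).trans_le (min_le_right _ _)
      rw [lt_div_iff₀ hK] at h4
      rw [hl]
      exact h3.trans_lt (by linarith)
    set σ : Fin p → ℝ := fun i =>
      if 0 < l i (x t) then a i else if l i (x t) < 0 then b i else w i with hσ
    have hσw : ∀ i, |σ i - w i| ≤ ε := fun i => by
      simp only [hσ]
      have h5 := abs_lt.1 (hyδ i)
      split_ifs with hp hn
      · rw [abs_sub_comm]
        exact (hδ i).1 _ hp h5.2 _ (hu i)
      · rw [abs_sub_comm]
        exact (hδ i).2 _ hn h5.1 _ (hu i)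
      · simpa using hε.le
    have hg : ∀ i, deriv (g i) t = σ i * ((C * A).mulVec (x t) - (C * B).mulVec w) i := fun i => by
      simp only [hσ]
      split_ifs with hp hn
      · exact deriv_tent_comp_of_pos (hab i) (hy i) hp
      · exact deriv_tent_comp_of_neg (hab i) (hy i) hn
      · obtain ⟨h6, h7⟩ := deriv_tent_comp_of_eq_zero (ha i) (hb i) (hy i) (h2 i ht)
          (le_antisymm (not_lt.1 hp) (not_lt.1 hn))
        rw [h6, mul_zero]
        exact h7
    have hwμ : μ ≤ ‖w‖ := by
      obtain ⟨i, hi⟩ : ∃ i, l i (x t) ≠ 0 := by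
        by_contra! hcon
        exact hVt.ne' (Finset.sum_eq_zero fun i _ => by simp [g, hcon i, tent])
      refine le_trans ?_ (norm_le_pi_norm w i)
      have h8 := abs_le.1 (hσw i)
      rw [Real.norm_eq_abs]
      rcases hi.lt_or_gt with hn | hp
      · have : σ i = b i := by simp [hσ, hn, hn.le.not_gt]
        exact le_trans (by linarith [(hμab i).2, h8.1]) (neg_le_abs (w i))
      · have : σ i = a i := by simp [hσ, hp]
        exact le_trans (by linarith [(hμab i).1, h8.2]) (le_abs_self (w i))
    have hdV : deriv V t =
        ∑ i, γ i * σ i * ((C * A).mulVec (x t) - (C * B).mulVec w) i := by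
      refine (HasDerivAt.fun_sum fun i _ => ((h2 i ht).hasDerivAt.const_mul (γ i))).deriv.trans ?_
      exact Finset.sum_congr rfl fun i _ => by rw [hg i, mul_assoc]
    rw [hdV]
    exact hdec _ _ _ ((hsmall t ht.le).le.trans (min_le_left _ _)) hwμ hσw
  have hfin := le_max_zero_sub_mul hκ.le hV0 hVAC hderiv ht
  have h9 : euclNorm (C.mulVec (x t)) ≤ m⁻¹ * V t := by
    rw [← div_eq_inv_mul, le_div_iff₀ hm, mul_comm]
    exact (mul_le_mul_of_nonneg_left (euclNorm_le_sum_abs _) hm.le).trans (hVlow t)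
  have h10 : 0 ≤ euclNorm (C.mulVec (x 0)) * Real.exp (-t) :=
    mul_nonneg (euclNorm_nonneg _) (Real.exp_pos _).le
  calc euclNorm (C.mulVec (x t)) ≤ m⁻¹ * V t := h9
    _ ≤ m⁻¹ * max 0 (E * euclNorm (C.mulVec (x 0)) - κ * t) := by
      gcongr
      exact hfin.trans (max_le_max le_rfl (by linarith))
    _ ≤ _ := le_add_of_nonneg_right h10
end
end

section
/- Let A ∈ ℝ^{n×n} be diagonal with strictly negative diagonal entries and B ∈ ℝ^{n×n} be Lyapunov diagonally stable. Then there exist a diagonal matrix Γ with positive entries such that ΓB + BᵀΓ is positive definite and every diagonal entry of ΓA is at most −1, a symmetric positive definite matrix P ∈ ℝ^{n×n}, and η > 0 such that the block matrix [[PA + AᵀP + ηIₙ, PB], [BᵀP, −(ΓB + BᵀΓ)]] is negative semidefinite. -/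
open Matrix

noncomputable section

/-- A quadratic form that is positive away from zero dominates every other quadratic form. -/
theorem exists_mulVec_dotProduct_le_mul {ι : Type*} [Fintype ι] (M N : Matrix ι ι ℝ)
    (hM : ∀ u : ι → ℝ, u ≠ 0 → 0 < u ⬝ᵥ (M *ᵥ u)) :
    ∃ K : ℝ, ∀ u : ι → ℝ, u ⬝ᵥ (N *ᵥ u) ≤ K * (u ⬝ᵥ (M *ᵥ u)) := by
  have hcont : ∀ L : Matrix ι ι ℝ, Continuous fun u : ι → ℝ => u ⬝ᵥ (L *ᵥ u) := fun L =>
    continuous_id.dotProduct (continuous_const.matrix_mulVec continuous_id)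
  have hne : ∀ u ∈ Metric.sphere (0 : ι → ℝ) 1, u ≠ 0 := fun u hu =>
    ne_zero_of_mem_unit_sphere ⟨u, hu⟩
  obtain ⟨K, hK⟩ := (isCompact_sphere (0 : ι → ℝ) 1).exists_bound_of_continuousOn
    (f := fun u => u ⬝ᵥ (N *ᵥ u) / (u ⬝ᵥ (M *ᵥ u)))
    ((hcont N).continuousOn.div (hcont M).continuousOn fun u hu => (hM u (hne u hu)).ne')
  refine ⟨K, fun u => ?_⟩
  rcases eq_or_ne u 0 with rfl | hu
  · simp
  have hn : ‖u‖ ≠ 0 := norm_ne_zero_iff.mpr hu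
  have hw : ‖u‖⁻¹ • u ∈ Metric.sphere (0 : ι → ℝ) 1 := by
    simp [norm_smul, hn]
  have hle := (le_abs_self _).trans (hK _ hw)
  simp only [mulVec_smul, dotProduct_smul, smul_dotProduct, smul_eq_mul] at hle
  rw [mul_div_mul_left _ _ (inv_ne_zero hn), mul_div_mul_left _ _ (inv_ne_zero hn)] at hle
  exact (div_le_iff₀ (hM u hu)).mp hle

/-- if `A` is diagonal with strictly negative diagonal entries
and `B` is Lyapunov diagonally stable, a positive diagonal `Γ` (with
`ΓB + BᵀΓ > 0` and `(ΓA)ᵢᵢ ≤ -1`), a symmetric positive definite `P` and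
`η > 0` exist making the indicated block matrix negative semidefinite. -/
theorem stmt14 {n : ℕ} (A B : Matrix (Fin n) (Fin n) ℝ) (d : Fin n → ℝ)
    (hA : A = Matrix.diagonal d) (hd : ∀ i, d i < 0)
    (hLDS : ∃ g : Fin n → ℝ, (∀ i, 0 < g i) ∧
      ∀ u : Fin n → ℝ, u ≠ 0 →
        0 < u ⬝ᵥ ((Matrix.diagonal g * B + Bᵀ * Matrix.diagonal g).mulVec u)) :
    ∃ g : Fin n → ℝ, (∀ i, 0 < g i) ∧
      (∀ u : Fin n → ℝ, u ≠ 0 →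
        0 < u ⬝ᵥ ((Matrix.diagonal g * B + Bᵀ * Matrix.diagonal g).mulVec u)) ∧
      (∀ i, (Matrix.diagonal g * A) i i ≤ -1) ∧
      ∃ P : Matrix (Fin n) (Fin n) ℝ, P.IsSymm ∧ P.PosDef ∧
        ∃ η : ℝ, 0 < η ∧
          ∀ v : Fin n ⊕ Fin n → ℝ,
            v ⬝ᵥ ((Matrix.fromBlocks
              (P * A + Aᵀ * P + η • (1 : Matrix (Fin n) (Fin n) ℝ))
              (P * B) (Bᵀ * P)
              (-(Matrix.diagonal g * B + Bᵀ * Matrix.diagonal g))).mulVec v) ≤ 0 := by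
  subst hA
  obtain ⟨g, hg, hpos⟩ := hLDS
  set M := Matrix.diagonal g * B + Bᵀ * Matrix.diagonal g
  set P : Matrix (Fin n) (Fin n) ℝ := Matrix.diagonal fun i => (-d i)⁻¹ with hP
  have hPpos : ∀ i, 0 < (-d i)⁻¹ := fun i => inv_pos.mpr (neg_pos.mpr (hd i))
  have hPsymm : Pᵀ = P := diagonal_transpose _
  have hPA : P * Matrix.diagonal d = -1 := by
    rw [hP, diagonal_mul_diagonal, ← diagonal_one, diagonal_neg]
    congr 1
    funext i
    have := (hd i).ne
    field_simp
  have hAP : (Matrix.diagonal d)ᵀ * P = -1 := by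
    rw [← hPsymm, ← transpose_mul, hPA, transpose_neg, transpose_one]
  obtain ⟨K, hK⟩ := exists_mulVec_dotProduct_le_mul M ((P * B)ᵀ * (P * B)) hpos
  have hterm : ∀ i, 0 < (g i * -d i)⁻¹ := fun i =>
    inv_pos.mpr (mul_pos (hg i) (neg_pos.mpr (hd i)))
  have hsum : 0 ≤ ∑ i, (g i * -d i)⁻¹ := Finset.sum_nonneg fun i _ => (hterm i).le
  set s : ℝ := |K| + 1 + ∑ i, (g i * -d i)⁻¹
  have hs0 : 0 < s := by positivity
  have hKs : K ≤ s := by linarith [le_abs_self K]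
  have hscale : Matrix.diagonal (s • g) * B + Bᵀ * Matrix.diagonal (s • g) = s • M := by
    rw [diagonal_smul, Matrix.smul_mul, Matrix.mul_smul, ← smul_add]
  refine ⟨s • g, fun i => mul_pos hs0 (hg i), fun u hu => ?_, fun i => ?_, P, hPsymm,
    PosDef.diagonal hPpos, 1, one_pos, fun v => ?_⟩
  · rw [hscale, smul_mulVec, dotProduct_smul]
    exact mul_pos hs0 (hpos u hu)
  · have hi : (g i * -d i)⁻¹ ≤ s := by
      have := Finset.single_le_sum (fun j _ => (hterm j).le) (Finset.mem_univ i)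
      linarith [abs_nonneg K]
    have := (inv_le_iff_one_le_mul₀ (mul_pos (hg i) (neg_pos.mpr (hd i)))).mp hi
    rw [diagonal_mul_diagonal, diagonal_apply_eq, Pi.smul_apply, smul_eq_mul]
    linarith
  · have hBP : Bᵀ * P = (P * B)ᵀ := by rw [transpose_mul, hPsymm]
    rw [hscale, hPA, hAP, hBP]
    obtain ⟨x, u, rfl⟩ : ∃ x u, v = Sum.elim x u := ⟨_, _, (Sum.elim_comp_inl_inr v).symm⟩
    set y := (P * B) *ᵥ u with hy
    have hq : 0 ≤ u ⬝ᵥ (M *ᵥ u) := by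
      rcases eq_or_ne u 0 with rfl | hu
      · simp
      · exact (hpos u hu).le
    have hyy : y ⬝ᵥ y ≤ s * (u ⬝ᵥ (M *ᵥ u)) := by
      refine le_trans (le_of_eq ?_) ((hK u).trans (mul_le_mul_of_nonneg_right hKs hq))
      rw [← mulVec_mulVec, dotProduct_mulVec u, vecMul_transpose]
    have hcross : u ⬝ᵥ ((P * B)ᵀ *ᵥ x) = x ⬝ᵥ y := by
      rw [dotProduct_mulVec, vecMul_transpose, dotProduct_comm]
    have hsq : 0 ≤ (x - y) ⬝ᵥ (x - y) := dotProduct_self_star_nonneg _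
    rw [sub_dotProduct, dotProduct_sub, dotProduct_sub, dotProduct_comm y x] at hsq
    rw [fromBlocks_mulVec]
    simp only [Sum.elim_comp_inl, Sum.elim_comp_inr, sumElim_dotProduct_sumElim, add_mulVec,
      neg_mulVec, one_mulVec, smul_mulVec, one_smul, dotProduct_add, dotProduct_neg,
      dotProduct_smul, smul_eq_mul, hcross, ← hy]
    linarith
end
end

section
/- Define the set-valued map Ψ₀ : ℝ → Set ℝ by Ψ₀(s) := {1} if s > 0, Ψ₀(s) := {−1/4} if s < 0, and Ψ₀(0) := [−1/4, 1]. Then for every (x₁, x₂) ∈ ℝ² with (x₁, x₂) ≠ (0, 0) and every u ∈ −Ψ₀(x₁), one has −x₁² + 2u x₁ − x₂² + u x₂ − u² < 0. -/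
noncomputable section

/-- The Krasovskii regularization of the example nonlinearity:
`Ψ₀(s) = {1}` for `s > 0`, `Ψ₀(s) = {-1/4}` for `s < 0`, `Ψ₀(0) = [-1/4, 1]`. -/
def Psi0 (s : ℝ) : Set ℝ :=
  if 0 < s then {1} else if s < 0 then {-(1/4)} else Set.Icc (-(1/4)) 1

/-- The sector condition: `s * w ≥ 0` for `w ∈ Psi0 s`, written for `u = -w`. -/
theorem mul_nonpos_of_neg_mem_Psi0 {s u : ℝ} (hu : -u ∈ Psi0 s) : u * s ≤ 0 := by
  unfold Psi0 at hu
  split_ifs at hu with hs hs'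
  · rw [Set.mem_singleton_iff] at hu
    nlinarith
  · rw [Set.mem_singleton_iff] at hu
    nlinarith
  · simp [le_antisymm (not_lt.mp hs) (not_lt.mp hs')]

/-- the Lie-derivative upper bound in the paper's Example 2 is
strictly negative away from the origin. -/
theorem stmt18 :
    ∀ x₁ x₂ : ℝ, (x₁, x₂) ≠ ((0 : ℝ), (0 : ℝ)) →
      ∀ u : ℝ, -u ∈ Psi0 x₁ →
        -x₁ ^ 2 + 2 * u * x₁ - x₂ ^ 2 + u * x₂ - u ^ 2 < 0 := by
  intro x₁ x₂ hne u hu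
  have hux : u * x₁ ≤ 0 := mul_nonpos_of_neg_mem_Psi0 hu
  have hpos : 0 < x₁ ^ 2 + x₂ ^ 2 := by
    by_contra! h
    have h₁ : x₁ = 0 := by nlinarith [sq_nonneg x₁, sq_nonneg x₂]
    have h₂ : x₂ = 0 := by nlinarith [sq_nonneg x₁, sq_nonneg x₂]
    exact hne (by rw [h₁, h₂])
  nlinarith [sq_nonneg (u - x₂ / 2), sq_nonneg x₁]
end
end

section
/- Let ψ : ℝ → ℝ have one-sided limits at 0: lim_{s→0⁺} ψ(s) = L⁺ and lim_{s→0⁻} ψ(s) = L⁻, with L⁻ ≤ L⁺. Then the interval [L⁻, L⁺] is contained in the Krasovskii regularization Ψ(0) := ⋂_{δ>0} closure(convexHull(ψ([−δ, δ]))). -/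
open Filter

noncomputable section

/-- if `ψ` has one-sided limits `L⁺` (from the right) and `L⁻`
(from the left) at `0` with `L⁻ ≤ L⁺`, then `[L⁻, L⁺] ⊆ Ψ(0)`. -/
theorem stmt19 (ψ : ℝ → ℝ) (Lp Lm : ℝ)
    (hp : Tendsto ψ (nhdsWithin 0 (Set.Ioi 0)) (nhds Lp))
    (hm : Tendsto ψ (nhdsWithin 0 (Set.Iio 0)) (nhds Lm))
    (hle : Lm ≤ Lp) :
    Set.Icc Lm Lp ⊆ kras ψ 0 := by
  refine Set.subset_iInter₂ fun δ hδ => ?_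
  have hδ : 0 < δ := hδ
  have hsub : ψ '' Set.Icc (0 - δ) (0 + δ) ⊆ convexHull ℝ (ψ '' Set.Icc (0 - δ) (0 + δ)) :=
    subset_convexHull ℝ _
  have hnhds : Set.Icc (0 - δ) (0 + δ) ∈ nhds (0 : ℝ) :=
    Icc_mem_nhds (by linarith) (by linarith)
  have mem_of_tendsto {L : ℝ} {s : Set ℝ} [(nhdsWithin 0 s).NeBot]
      (h : Tendsto ψ (nhdsWithin 0 s) (nhds L)) :
      L ∈ closure (convexHull ℝ (ψ '' Set.Icc (0 - δ) (0 + δ))) :=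
    mem_closure_of_tendsto h <| by
      filter_upwards [mem_nhdsWithin_of_mem_nhds hnhds] with x hx
      exact hsub (Set.mem_image_of_mem ψ hx)
  exact (convex_convexHull ℝ _).closure.ordConnected.out (mem_of_tendsto hm) (mem_of_tendsto hp)
end
end
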